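/- There exists a constant c(d, n) > 0, depending only on d and n, such that the following holds. Let K be a convex compact set in ℝ^n of positive volume, let λ_K be the normalized Lebesgue measure on K, and let f be a polynomial of degree at most d on ℝ^n. Suppose ℝ = J₁ ⊔ J₂ ⊔ J₃ is a partition into disjoint measurable sets with inf{|x₁ − x₃| : x₁ ∈ J₁, x₃ ∈ J₃} = ε > 0. Then ε · λ_K({f ∈ J₁}) · λ_K({f ∈ J₃}) ≤ c(d, n) · λ_K({f ∈ J₂}) · ∫_K |f − m_f| dλ_K, where m_f = ∫_K f dλ_K. -/

import Mathlib

open MeasureTheory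

/-- `f` is a polynomial of degree at most `d` on `ℝ^n`. -/
def IsPolyDeg {n : ℕ} (d : ℕ) (f : EuclideanSpace ℝ (Fin n) → ℝ) : Prop :=
  ∃ p : MvPolynomial (Fin n) ℝ, p.totalDegree ≤ d ∧
    ∀ x, f x = MvPolynomial.eval (fun i => x i) p

/-- The normalized Lebesgue measure (uniform distribution) on a set `K ⊂ ℝ^n`. -/
noncomputable def unifOn {n : ℕ} (K : Set (EuclideanSpace ℝ (Fin n))) :
    Measure (EuclideanSpace ℝ (Fin n)) :=
  (volume K)⁻¹ • volume.restrict K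

open scoped ENNReal NNReal

lemma coeff_bound (d n : ℕ) : ∃ C : ℝ, 0 < C ∧ ∀ a : Fin (d+1) → ℝ,
    ‖a‖ ≤ C * ∫ t in (0:ℝ)..1, t^n * |∑ i, a i * t^(i:ℕ)| := by
  set N : (Fin (d+1) → ℝ) → ℝ := fun a => ∫ t in (0:ℝ)..1, t^n * |∑ i, a i * t^(i:ℕ)| with hN
  have hcont : Continuous N := by
    apply intervalIntegral.continuous_parametric_intervalIntegral_of_continuous'
    unfold Function.uncurry
    fun_prop
  have hpos : ∀ a, a ≠ 0 → 0 < N a := by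
    intro a ha
    apply intervalIntegral.integral_pos zero_lt_one (by fun_prop)
    · intro t ht
      have := ht.1.le
      positivity
    · by_contra! hcon
      apply ha
      have hz : ∀ t ∈ Set.Ioo (0:ℝ) 1, ∑ i, a i * t^(i:ℕ) = 0 := by
        intro t ht
        have h1 := hcon t (Set.Ioo_subset_Icc_self ht)
        have h2 : 0 < t^n := pow_pos ht.1 n
        have h3 : |∑ i, a i * t^(i:ℕ)| ≤ 0 := by
          by_contra! h4
          exact absurd h1 (not_le.2 (mul_pos h2 h4))
        exact abs_eq_zero.1 (le_antisymm h3 (abs_nonneg _))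
      have hp : (∑ i : Fin (d+1), Polynomial.monomial (i:ℕ) (a i)) = 0 := by
        apply Polynomial.eq_zero_of_infinite_isRoot
        refine (Set.Ioo_infinite (zero_lt_one (α := ℝ))).mono fun t ht => ?_
        simp only [Set.mem_ofPred_eq, Polynomial.IsRoot.def, Polynomial.eval_finsetSum,
          Polynomial.eval_monomial]
        exact hz t ht
      ext j
      have := congrArg (fun q => Polynomial.coeff q (j:ℕ)) hp
      simpa [Polynomial.finsetSum_coeff, Polynomial.coeff_monomial, Fin.val_inj] using this
  have hhom : ∀ (r : ℝ) a, N (r • a) = |r| * N a := by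
    intro r a
    simp only [hN]
    rw [← intervalIntegral.integral_const_mul]
    congr 1
    ext t
    have : ∑ i, (r • a) i * t^(i:ℕ) = r * ∑ i, a i * t^(i:ℕ) := by
      rw [Finset.mul_sum]
      exact Finset.sum_congr rfl fun i _ => by simp; ring
    rw [this, abs_mul]; ring
  obtain ⟨b, hb, hmin⟩ := (isCompact_sphere (0 : Fin (d+1) → ℝ) 1).exists_isMinOn
    (NormedSpace.sphere_nonempty.2 zero_le_one) hcont.continuousOn
  have hb0 : b ≠ 0 := by
    rintro rfl
    simp at hb
  have hNb := hpos b hb0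
  refine ⟨(N b)⁻¹, inv_pos.2 hNb, fun a => ?_⟩
  change ‖a‖ ≤ (N b)⁻¹ * N a
  by_cases ha : a = 0
  · subst ha
    have := hhom 0 0
    simp at this
    simp [this]
  have hna : 0 < ‖a‖ := norm_pos_iff.2 ha
  have h1 : N b ≤ N (‖a‖⁻¹ • a) := hmin (by simp [norm_smul, hna.ne'])
  rw [hhom, abs_of_pos (inv_pos.2 hna)] at h1
  rw [inv_mul_eq_div, le_div_iff₀ hNb]
  calc ‖a‖ * N b ≤ ‖a‖ * (‖a‖⁻¹ * N a) := by gcongr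
    _ = N a := by field_simp

lemma line_poly {n d : ℕ} {f : EuclideanSpace ℝ (Fin n) → ℝ} (hf : IsPolyDeg d f)
    (x y : EuclideanSpace ℝ (Fin n)) :
    ∃ a : Fin (d+1) → ℝ, ∀ t : ℝ, f (x + t • (y - x)) = ∑ i, a i * t^(i:ℕ) := by
  obtain ⟨p, hp, hpf⟩ := hf
  obtain ⟨w, hw⟩ : ∃ w : Fin n → Polynomial ℝ, ∀ i,
    w i = Polynomial.C (y i - x i) * Polynomial.X + Polynomial.C (x i) := ⟨_, fun _ => rfl⟩
  have hdeg : (MvPolynomial.aeval w p).natDegree ≤ d * 1 :=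
    MvPolynomial.aeval_natDegree_le p hp w
      (fun i => by rw [hw]; exact Polynomial.natDegree_linear_le)
  have hev : ∀ t : ℝ, f (x + t • (y - x)) = (MvPolynomial.aeval w p).eval t := by
    intro t
    rw [hpf, ← Polynomial.coe_evalRingHom, MvPolynomial.aeval_def, MvPolynomial.hom_eval₂,
      MvPolynomial.eval, MvPolynomial.coe_eval₂Hom]
    congr 1
    · ext; simp
    · ext i; simp [hw]; ring
  generalize MvPolynomial.aeval w p = q at hdeg hev
  refine ⟨fun i => q.coeff i, fun t => ?_⟩
  rw [Fin.sum_univ_eq_sum_range (fun i => q.coeff i * t ^ i) (d+1),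
    ← Polynomial.eval_eq_sum_range' (by omega), hev]

lemma poly_cont {n d : ℕ} {f : EuclideanSpace ℝ (Fin n) → ℝ} (hf : IsPolyDeg d f) :
    Continuous f := by
  obtain ⟨p, hp, hpf⟩ := hf
  have : f = fun x => MvPolynomial.eval (fun i => x i) p := funext hpf
  rw [this]
  have h1 := MvPolynomial.continuous_eval p
  exact h1.comp (by fun_prop : Continuous fun (x : EuclideanSpace ℝ (Fin n)) (i : Fin n) => x i)

lemma poly_sub {n d : ℕ} {f : EuclideanSpace ℝ (Fin n) → ℝ} (hf : IsPolyDeg d f) (m : ℝ) :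
    IsPolyDeg d (fun x => f x - m) := by
  obtain ⟨p, hp, hpf⟩ := hf
  refine ⟨p - MvPolynomial.C m, ?_, fun x => by simp [hpf]⟩
  exact (MvPolynomial.totalDegree_sub _ _).trans (by simp [hp])

lemma sum_lip {d : ℕ} (a : Fin (d+1) → ℝ) {s t : ℝ} (hs : s ∈ Set.Icc (0:ℝ) 1)
    (ht : t ∈ Set.Icc (0:ℝ) 1) :
    |∑ i, a i * s^(i:ℕ) - ∑ i, a i * t^(i:ℕ)| ≤ ((d+1)^2 * ‖a‖) * |s - t| := by
  rw [← Finset.sum_sub_distrib]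
  have : ∀ i ∈ Finset.univ, |a i * s^(i:ℕ) - a i * t^(i:ℕ)| ≤ (d+1) * ‖a‖ * |s - t| := by
    intro i _
    rw [← mul_sub, abs_mul]
    have h1 : |a i| ≤ ‖a‖ := norm_le_pi_norm a i
    have h2 := abs_pow_sub_pow_le s t (i:ℕ)
    have h3 : max |s| |t| ^ ((i:ℕ) - 1) ≤ 1 := by
      apply pow_le_one₀ (by positivity)
      rw [abs_of_nonneg hs.1, abs_of_nonneg ht.1]
      exact max_le hs.2 ht.2
    have h4 : ((i:ℕ):ℝ) ≤ d + 1 := by exact_mod_cast i.2.le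
    calc |a i| * |s^(i:ℕ) - t^(i:ℕ)| ≤ ‖a‖ * (|s - t| * (d+1) * 1) := by
          gcongr
          exact h2.trans (by gcongr)
      _ = _ := by ring
  refine (Finset.abs_sum_le_sum_abs _ _).trans ((Finset.sum_le_sum this).trans ?_)
  simp
  apply le_of_eq; ring

/-- One dimensional crossing lemma. -/
lemma crossing (g : ℝ → ℝ) (L : ℝ≥0) (hg : LipschitzOnWith L g (Set.Icc 0 1))
    (J1 J2 J3 : Set ℝ) (hU : J1 ∪ J2 ∪ J3 = Set.univ) (ε : ℝ)
    (hsep : ∀ x1 ∈ J1, ∀ x3 ∈ J3, ε ≤ |x1 - x3|) (h0 : g 0 ∈ J1) (h1 : g 1 ∈ J3) :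
    ENNReal.ofReal ε ≤ L * volume (Set.Icc (0:ℝ) 1 ∩ g ⁻¹' J2) := by
  set φ : ℝ → ℝ := fun z => Metric.infDist z J1
  have hφ : LipschitzWith 1 φ := Metric.lipschitz_infDist_pt J1
  have hne : J1.Nonempty := ⟨_, h0⟩
  have hJ3 : ∀ z ∈ J3, ε ≤ φ z := by
    intro z hz
    refine (Metric.le_infDist hne).2 fun y hy => ?_
    rw [dist_comm]; exact hsep y hy z hz
  have hJ1 : ∀ z ∈ J1, φ z = 0 := fun z hz => Metric.infDist_zero_of_mem hz
  have hc : LipschitzOnWith L (φ ∘ g) (Set.Icc 0 1) := by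
    simpa using hφ.comp_lipschitzOnWith hg
  have hsub : Set.Ioo 0 ε ⊆ (φ ∘ g) '' (Set.Icc (0:ℝ) 1 ∩ g ⁻¹' J2) := by
    intro z hz
    have hz' : z ∈ Set.Ioo ((φ ∘ g) 0) ((φ ∘ g) 1) :=
      ⟨by simpa [hJ1 _ h0] using hz.1, hz.2.trans_le (hJ3 _ h1)⟩
    obtain ⟨t, ht, rfl⟩ := intermediate_value_Ioo zero_le_one hc.continuousOn hz'
    refine ⟨t, ⟨Set.Ioo_subset_Icc_self ht, ?_⟩, rfl⟩
    have : g t ∈ J1 ∪ J2 ∪ J3 := by rw [hU]; trivial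
    rcases this with (h | h) | h
    · have := hJ1 _ h
      have h2 := hz.1
      simp only [Function.comp] at h2
      linarith
    · exact h
    · have := hJ3 _ h
      have h2 := hz.2
      simp only [Function.comp] at h2
      linarith
  have h3 := (hc.mono (Set.inter_subset_left (t := g ⁻¹' J2))).hausdorffMeasure_image_le
    (d := 1) zero_le_one
  rw [hausdorffMeasure_real, ENNReal.rpow_one] at h3
  calc ENNReal.ofReal ε = volume (Set.Ioo 0 ε) := by simp
    _ ≤ _ := measure_mono hsub
    _ ≤ _ := h3

lemma scale {n : ℕ} {φ : EuclideanSpace ℝ (Fin n) → ℝ≥0∞} (hφ : Measurable φ)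
    (b : EuclideanSpace ℝ (Fin n)) {r : ℝ} (hr : r ≠ 0) :
    ∫⁻ y, φ (b + r • y) = ENNReal.ofReal |(r^n)⁻¹| * ∫⁻ y, φ y := by
  have h1 : ∫⁻ y, φ (b + r • y) = ∫⁻ y, φ (b + y) ∂(Measure.map (r • ·) volume) := by
    rw [lintegral_map (by fun_prop) (by fun_prop)]
  rw [h1, Measure.map_addHaar_smul _ hr, lintegral_smul_measure, smul_eq_mul,
    lintegral_add_left_eq_self (μ := volume) φ b]
  simp

lemma scale_le {n : ℕ} {φ : EuclideanSpace ℝ (Fin n) → ℝ≥0∞} (hφ : Measurable φ)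
    (b : EuclideanSpace ℝ (Fin n)) {r : ℝ} (hr : 1/2 ≤ r) :
    ∫⁻ y, φ (b + r • y) ≤ 2^n * ∫⁻ y, φ y := by
  rw [scale hφ b (by linarith : r ≠ 0)]
  gcongr
  have h2 : |(r^n)⁻¹| ≤ 2^n := by
    have : 0 < r := by linarith
    rw [abs_of_pos (by positivity), ← inv_pow]
    gcongr
    rw [inv_le_comm₀ this (by norm_num)]; linarith
  calc ENNReal.ofReal |(r^n)⁻¹| ≤ ENNReal.ofReal (2^n) := ENNReal.ofReal_le_ofReal h2
    _ = 2^n := by rw [ENNReal.ofReal_pow (by norm_num)]; simp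

lemma avg_bound {n : ℕ} {φ : EuclideanSpace ℝ (Fin n) → ℝ≥0∞} (hφ : Measurable φ)
    (K : Set (EuclideanSpace ℝ (Fin n))) :
    ∫⁻ x in K, ∫⁻ y in K, ∫⁻ t in Set.Icc (0:ℝ) 1, φ (x + t • (y - x)) ≤
      2^n * volume K * ∫⁻ y, φ y := by
  have e1 : ∫⁻ x in K, ∫⁻ y in K, ∫⁻ t in Set.Icc (0:ℝ) 1, φ (x + t • (y - x))
      = ∫⁻ t in Set.Icc (0:ℝ) 1, ∫⁻ x in K, ∫⁻ y in K, φ (x + t • (y - x)) := by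
    have e2 : ∀ x, ∫⁻ y in K, ∫⁻ t in Set.Icc (0:ℝ) 1, φ (x + t • (y - x)) =
        ∫⁻ t in Set.Icc (0:ℝ) 1, ∫⁻ y in K, φ (x + t • (y - x)) := by
      intro x
      rw [lintegral_lintegral_swap]
      apply Measurable.aemeasurable
      unfold Function.uncurry
      fun_prop
    simp_rw [e2]
    rw [lintegral_lintegral_swap]
    apply Measurable.aemeasurable
    unfold Function.uncurry
    apply Measurable.lintegral_prod_right'
      (f := fun z : (EuclideanSpace ℝ (Fin n) × ℝ) × EuclideanSpace ℝ (Fin n) =>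
        φ (z.1.1 + z.1.2 • (z.2 - z.1.1)))
    fun_prop
  rw [e1]
  have key : ∀ t : ℝ, ∫⁻ x in K, ∫⁻ y in K, φ (x + t • (y - x)) ≤
      2^n * volume K * ∫⁻ y, φ y := by
    intro t
    rcases le_total (1/2) t with ht | ht
    · calc ∫⁻ x in K, ∫⁻ y in K, φ (x + t • (y - x))
          ≤ ∫⁻ x in K, 2^n * ∫⁻ y, φ y := by
            refine lintegral_mono fun x => ?_
            refine (setLIntegral_le_lintegral _ _).trans ?_
            refine le_trans (le_of_eq ?_) (scale_le hφ (x - t • x) ht)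
            refine lintegral_congr fun y => ?_
            congr 1; module
        _ = _ := by rw [setLIntegral_const]; ring
    · rw [lintegral_lintegral_swap (by
        apply Measurable.aemeasurable
        unfold Function.uncurry
        fun_prop)]
      calc ∫⁻ y in K, ∫⁻ x in K, φ (x + t • (y - x))
          ≤ ∫⁻ y in K, 2^n * ∫⁻ y, φ y := by
            refine lintegral_mono fun y => ?_
            refine (setLIntegral_le_lintegral _ _).trans ?_
            refine le_trans (le_of_eq ?_) (scale_le hφ (t • y) (r := 1 - t) (by linarith))
            refine lintegral_congr fun x => ?_
            congr 1; module
        _ = _ := by rw [setLIntegral_const]; ring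
  calc _ ≤ ∫⁻ t in Set.Icc (0:ℝ) 1, 2^n * volume K * ∫⁻ y, φ y := lintegral_mono fun t => key t
    _ = _ := by simp

lemma sup_bound (d n : ℕ) : ∃ C : ℝ, 0 < C ∧
    ∀ K : Set (EuclideanSpace ℝ (Fin n)), Convex ℝ K → IsCompact K →
      ∀ h : EuclideanSpace ℝ (Fin n) → ℝ, IsPolyDeg d h → ∀ x0 ∈ K,
      |h x0| * (volume K).toReal ≤ C * ∫ x in K, |h x| := by
  obtain ⟨C, hC, hCb⟩ := coeff_bound d n
  refine ⟨C, hC, fun K hconv hK h hh x0 hx0 => ?_⟩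
  have hc := poly_cont hh
  have hKm : MeasurableSet K := hK.measurableSet
  set ψ : EuclideanSpace ℝ (Fin n) → ℝ≥0∞ := K.indicator (fun x => ENNReal.ofReal |h x|) with hψ
  have hψm : Measurable ψ :=
    Measurable.indicator (by have := hc.measurable; fun_prop) hKm
  have hint : ∫⁻ x, ψ x = ENNReal.ofReal (∫ x in K, |h x|) := by
    rw [hψ, lintegral_indicator hKm, ofReal_integral_eq_lintegral_ofReal]
    · exact (hc.abs.continuousOn.integrableOn_compact hK)
    · exact Filter.Eventually.of_forall fun x => abs_nonneg _
  have hup : ∫⁻ y in K, ∫⁻ t in Set.Ioc (0:ℝ) 1, ENNReal.ofReal (t^n) * ψ (x0 + t • (y - x0))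
      ≤ ∫⁻ x, ψ x := by
    rw [lintegral_lintegral_swap (by
      apply Measurable.aemeasurable
      unfold Function.uncurry
      fun_prop)]
    calc _ ≤ ∫⁻ t in Set.Ioc (0:ℝ) 1, ∫⁻ x, ψ x := by
          refine setLIntegral_mono measurable_const fun t ht => ?_
          have htn : 0 < t^n := pow_pos ht.1 n
          rw [lintegral_const_mul _ (by fun_prop)]
          have h1 : ∫⁻ y in K, ψ (x0 + t • (y - x0)) ≤
              ENNReal.ofReal |(t^n)⁻¹| * ∫⁻ y, ψ y := by
            rw [← scale hψm (x0 - t • x0) ht.1.ne']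
            refine (setLIntegral_le_lintegral _ _).trans (le_of_eq ?_)
            refine lintegral_congr fun y => ?_
            congr 1; module
          calc _ ≤ ENNReal.ofReal (t^n) * (ENNReal.ofReal |(t^n)⁻¹| * ∫⁻ y, ψ y) := by gcongr
            _ = _ := by
              rw [← mul_assoc, ← ENNReal.ofReal_mul htn.le, abs_of_pos (inv_pos.2 htn),
                mul_inv_cancel₀ htn.ne']
              simp
      _ = _ := by simp
  have hlow : ∀ y ∈ K, ENNReal.ofReal (|h x0| / C) ≤
      ∫⁻ t in Set.Ioc (0:ℝ) 1, ENNReal.ofReal (t^n) * ψ (x0 + t • (y - x0)) := by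
    intro y hy
    obtain ⟨a, ha⟩ := line_poly hh x0 y
    have h0 : h x0 = a 0 := by
      have := ha 0
      rw [Fin.sum_univ_succ] at this
      simpa using this
    have e : ∫⁻ t in Set.Ioc (0:ℝ) 1, ENNReal.ofReal (t^n) * ψ (x0 + t • (y - x0)) =
        ENNReal.ofReal (∫ t in (0:ℝ)..1, t^n * |∑ i, a i * t^(i:ℕ)|) := by
      rw [intervalIntegral.integral_of_le zero_le_one, ofReal_integral_eq_lintegral_ofReal]
      · refine setLIntegral_congr_fun measurableSet_Ioc fun t ht => ?_
        have hmem : x0 + t • (y - x0) ∈ K :=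
          hconv.add_smul_sub_mem hx0 hy ⟨ht.1.le, ht.2⟩
        simp only [hψ, Set.indicator_of_mem hmem, ha]
        rw [ENNReal.ofReal_mul (pow_nonneg ht.1.le n)]
      · have : Continuous fun t : ℝ => t^n * |∑ i, a i * t^(i:ℕ)| := by fun_prop
        exact (this.continuousOn.integrableOn_compact isCompact_Icc).mono_set
          Set.Ioc_subset_Icc_self
      · refine (ae_restrict_iff' measurableSet_Ioc).2 (Filter.Eventually.of_forall fun t ht => ?_)
        have := ht.1.le
        simp only [Pi.zero_apply]
        positivity
    rw [e]
    apply ENNReal.ofReal_le_ofReal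
    rw [div_le_iff₀ hC, h0, mul_comm]
    exact (norm_le_pi_norm a 0).trans (hCb a)
  have hfin : ENNReal.ofReal (|h x0| / C) * volume K ≤ ENNReal.ofReal (∫ x in K, |h x|) := by
    rw [← hint]
    refine le_trans ?_ hup
    rw [← setLIntegral_const]
    exact setLIntegral_mono' hKm hlow
  have := ENNReal.toReal_mono (by simp) hfin
  rw [ENNReal.toReal_mul, ENNReal.toReal_ofReal (by positivity),
    ENNReal.toReal_ofReal (integral_nonneg fun x => abs_nonneg _)] at this
  calc |h x0| * (volume K).toReal = C * (|h x0| / C * (volume K).toReal) := by field_simp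
    _ ≤ _ := by gcongr

lemma volume_bound (d n : ℕ) : ∃ C : ℝ, 0 < C ∧
    ∀ K : Set (EuclideanSpace ℝ (Fin n)), Convex ℝ K → IsCompact K →
      ∀ f : EuclideanSpace ℝ (Fin n) → ℝ, IsPolyDeg d f → ∀ m M : ℝ, 0 ≤ M →
      (∀ x ∈ K, |f x - m| ≤ M) →
      ∀ J1 J2 J3 : Set ℝ, MeasurableSet J1 → MeasurableSet J2 → MeasurableSet J3 →
        J1 ∪ J2 ∪ J3 = Set.univ →
        ∀ ε : ℝ, 0 < ε → (∀ x1 ∈ J1, ∀ x3 ∈ J3, ε ≤ |x1 - x3|) →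
        ENNReal.ofReal ε * volume (f ⁻¹' J1 ∩ K) * volume (f ⁻¹' J3 ∩ K) ≤
          ENNReal.ofReal (C * M) * volume K * volume (f ⁻¹' J2 ∩ K) := by
  obtain ⟨C, hC, hCb⟩ := coeff_bound d n
  refine ⟨((d+1)^2 * C) * 2^n, by positivity, ?_⟩
  intro K hconv hK f hf m M hM hfM J1 J2 J3 hJ1 hJ2 hJ3 hU ε hε hsep
  have hc := poly_cont hf
  have hKm : MeasurableSet K := hK.measurableSet
  have hm : ∀ J, MeasurableSet J → MeasurableSet (f ⁻¹' J ∩ K) :=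
    fun J hJ => (hc.measurable hJ).inter hKm
  set S := f ⁻¹' J2 ∩ K with hS
  set φ : EuclideanSpace ℝ (Fin n) → ℝ≥0∞ := S.indicator 1 with hφ
  have hφm : Measurable φ := Measurable.indicator measurable_one (hm J2 hJ2)
  have hφi : ∫⁻ x, φ x = volume S := lintegral_indicator_one (hm J2 hJ2)
  set L : ℝ≥0 := Real.toNNReal ((d+1)^2 * C * M) with hL
  have hLe : (L : ℝ) = (d+1)^2 * C * M := Real.coe_toNNReal _ (by positivity)
  have hcross : ∀ x ∈ f ⁻¹' J1 ∩ K, ∀ y ∈ f ⁻¹' J3 ∩ K,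
      ENNReal.ofReal ε ≤ L * ∫⁻ t in Set.Icc (0:ℝ) 1, φ (x + t • (y - x)) := by
    intro x hx y hy
    obtain ⟨a, ha⟩ := line_poly (poly_sub hf m) x y
    have hmem : ∀ t ∈ Set.Icc (0:ℝ) 1, x + t • (y - x) ∈ K :=
      fun t ht => hconv.add_smul_sub_mem hx.2 hy.2 ht
    have hna : ‖a‖ ≤ C * M := by
      refine (hCb a).trans ?_
      gcongr
      have h1 : ∫ t in (0:ℝ)..1, t^n * |∑ i, a i * t^(i:ℕ)| ≤ ∫ t in (0:ℝ)..1, M := by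
        apply intervalIntegral.integral_mono_on zero_le_one
        · apply Continuous.intervalIntegrable; fun_prop
        · simp
        · intro t ht
          rw [← ha]
          have h2 := hfM _ (hmem t ht)
          have h3 : t^n ≤ 1 := pow_le_one₀ ht.1 ht.2
          have h4 : 0 ≤ t^n := pow_nonneg ht.1 n
          calc _ ≤ 1 * M := by gcongr
            _ = M := one_mul M
      simpa using h1
    have hlip : LipschitzOnWith L (fun t : ℝ => f (x + t • (y - x))) (Set.Icc 0 1) := by
      apply LipschitzOnWith.of_dist_le_mul
      intro s hs t ht
      rw [Real.dist_eq, Real.dist_eq, hLe]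
      have e : f (x + s • (y - x)) - f (x + t • (y - x)) =
          ∑ i, a i * s^(i:ℕ) - ∑ i, a i * t^(i:ℕ) := by
        rw [← ha, ← ha]; ring
      rw [e]
      refine (sum_lip a hs ht).trans ?_
      calc ((d:ℝ)+1)^2 * ‖a‖ * |s - t| ≤ (d+1)^2 * (C * M) * |s - t| := by gcongr
        _ = _ := by ring
    have h1 := crossing _ L hlip J1 J2 J3 hU ε hsep (by simpa using hx.1) (by simpa using hy.1)
    refine h1.trans ?_
    gcongr
    have hcl : Continuous fun t : ℝ => f (x + t • (y - x)) := by fun_prop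
    rw [Set.inter_comm, ← Measure.restrict_apply (hcl.measurable hJ2),
      ← lintegral_indicator_one (hcl.measurable hJ2)]
    refine setLIntegral_mono' measurableSet_Icc fun t ht => ?_
    by_cases h : f (x + t • (y - x)) ∈ J2
    · have h2 : x + t • (y - x) ∈ S := ⟨h, hmem t ht⟩
      rw [hφ, Set.indicator_of_mem h2, Set.indicator_of_mem (by exact h)]
      simp
    · rw [Set.indicator_of_notMem (by exact h)]
      simp
  have hmeas2 : ∀ x, Measurable fun y => ∫⁻ t in Set.Icc (0:ℝ) 1, φ (x + t • (y - x)) := by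
    intro x
    apply Measurable.lintegral_prod_right'
      (f := fun z : EuclideanSpace ℝ (Fin n) × ℝ => φ (x + z.2 • (z.1 - x)))
    fun_prop
  have hmeas1 : Measurable fun x => ∫⁻ y in K, ∫⁻ t in Set.Icc (0:ℝ) 1, φ (x + t • (y - x)) := by
    apply Measurable.lintegral_prod_right' (f := fun z : EuclideanSpace ℝ (Fin n) ×
      EuclideanSpace ℝ (Fin n) => ∫⁻ t in Set.Icc (0:ℝ) 1, φ (z.1 + t • (z.2 - z.1)))
    apply Measurable.lintegral_prod_right' (f := fun z : (EuclideanSpace ℝ (Fin n) ×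
      EuclideanSpace ℝ (Fin n)) × ℝ => φ (z.1.1 + z.2 • (z.1.2 - z.1.1)))
    fun_prop
  calc ENNReal.ofReal ε * volume (f ⁻¹' J1 ∩ K) * volume (f ⁻¹' J3 ∩ K)
      = ∫⁻ x in f ⁻¹' J1 ∩ K, ∫⁻ y in f ⁻¹' J3 ∩ K, ENNReal.ofReal ε := by
        rw [setLIntegral_const, setLIntegral_const]; ring
    _ ≤ ∫⁻ x in f ⁻¹' J1 ∩ K, ∫⁻ y in f ⁻¹' J3 ∩ K,
          L * ∫⁻ t in Set.Icc (0:ℝ) 1, φ (x + t • (y - x)) :=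
        setLIntegral_mono' (hm J1 hJ1) fun x hx =>
          setLIntegral_mono' (hm J3 hJ3) fun y hy => hcross x hx y hy
    _ ≤ ∫⁻ x in f ⁻¹' J1 ∩ K, ∫⁻ y in K,
          L * ∫⁻ t in Set.Icc (0:ℝ) 1, φ (x + t • (y - x)) :=
        lintegral_mono fun x => lintegral_mono_set Set.inter_subset_right
    _ ≤ ∫⁻ x in K, ∫⁻ y in K,
          L * ∫⁻ t in Set.Icc (0:ℝ) 1, φ (x + t • (y - x)) :=
        lintegral_mono_set Set.inter_subset_right
    _ = L * ∫⁻ x in K, ∫⁻ y in K, ∫⁻ t in Set.Icc (0:ℝ) 1, φ (x + t • (y - x)) := by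
        rw [← lintegral_const_mul _ hmeas1]
        refine lintegral_congr fun x => ?_
        rw [← lintegral_const_mul _ (hmeas2 x)]
    _ ≤ L * (2^n * volume K * ∫⁻ y, φ y) := by
        gcongr
        exact avg_bound hφm K
    _ = _ := by
        rw [hφi]
        have : ENNReal.ofReal ((d+1)^2 * C * 2^n * M) = L * 2^n := by
          rw [show ((d:ℝ)+1)^2 * C * 2^n * M = ((d+1)^2 * C * M) * 2^n by ring,
            ENNReal.ofReal_mul (by positivity), ENNReal.ofReal_pow (by norm_num)]
          simp [hL, ENNReal.ofReal]
        rw [this]; ring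

/-- Theorem 3.5: there is `c(d,n) > 0` such that for every convex compact `K ⊂ ℝ^n` of
positive volume, every polynomial `f` of degree at most `d`, and every measurable partition
`ℝ = J₁ ⊔ J₂ ⊔ J₃` with `dist(J₁, J₃) = ε > 0`,
`ε λ_K(f ∈ J₁) λ_K(f ∈ J₃) ≤ c(d,n) λ_K(f ∈ J₂) ∫_K |f - m_f| dλ_K`. -/
theorem separated_sets_localization (d n : ℕ) :
    ∃ c : ℝ, 0 < c ∧
      ∀ K : Set (EuclideanSpace ℝ (Fin n)), Convex ℝ K → IsCompact K → volume K ≠ 0 →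
        ∀ f : EuclideanSpace ℝ (Fin n) → ℝ, IsPolyDeg d f →
          ∀ J1 J2 J3 : Set ℝ, MeasurableSet J1 → MeasurableSet J2 → MeasurableSet J3 →
            Disjoint J1 J2 → Disjoint J1 J3 → Disjoint J2 J3 →
            J1 ∪ J2 ∪ J3 = Set.univ →
            ∀ ε : ℝ, 0 < ε → (∀ x1 ∈ J1, ∀ x3 ∈ J3, ε ≤ |x1 - x3|) →
              ε * ((unifOn K) (f ⁻¹' J1)).toReal * ((unifOn K) (f ⁻¹' J3)).toReal ≤
                c * ((unifOn K) (f ⁻¹' J2)).toReal *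
                  ∫ x, |f x - ∫ y, f y ∂(unifOn K)| ∂(unifOn K) := by
  obtain ⟨C1, hC1, h1⟩ := sup_bound d n
  obtain ⟨C2, hC2, h2⟩ := volume_bound d n
  refine ⟨C2 * C1, by positivity, ?_⟩
  intro K hconv hK hV f hf J1 J2 J3 hJ1 hJ2 hJ3 _ _ _ hU ε hε hsep
  have hKm : MeasurableSet K := hK.measurableSet
  have hVt : volume K ≠ ⊤ := hK.measure_ne_top
  have hc := poly_cont hf
  generalize hm : ∫ y, f y ∂(unifOn K) = m
  set V := (volume K).toReal with hVdef
  have hVpos : 0 < V := ENNReal.toReal_pos hV hVt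
  have hne : K.Nonempty := by
    by_contra h
    rw [Set.not_nonempty_iff_eq_empty] at h
    exact hV (by simp [h])
  obtain ⟨x0, hx0, hmax⟩ := hK.exists_isMaxOn hne
    ((hc.sub continuous_const).abs (f := fun x => f x - m)).continuousOn
  have hsup := h1 K hconv hK _ (poly_sub hf m) x0 hx0
  have hvol := h2 K hconv hK f hf m |f x0 - m| (abs_nonneg _) (fun x hx => hmax hx)
    J1 J2 J3 hJ1 hJ2 hJ3 hU ε hε hsep
  have hfin : ∀ J : Set ℝ, volume (f ⁻¹' J ∩ K) ≠ ⊤ := fun J =>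
    ne_top_of_le_ne_top hVt (measure_mono Set.inter_subset_right)
  have hu : ∀ J : Set ℝ, MeasurableSet J →
      ((unifOn K) (f ⁻¹' J)).toReal = V⁻¹ * (volume (f ⁻¹' J ∩ K)).toReal := by
    intro J hJ
    rw [unifOn, Measure.smul_apply, Measure.restrict_apply (hc.measurable hJ), smul_eq_mul,
      ENNReal.toReal_mul, ENNReal.toReal_inv]
  have hI : ∫ x, |f x - m| ∂(unifOn K) = V⁻¹ * ∫ x in K, |f x - m| := by
    rw [unifOn, integral_smul_measure, ENNReal.toReal_inv, smul_eq_mul]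
  rw [hu J1 hJ1, hu J2 hJ2, hu J3 hJ3, hI]
  have hr := ENNReal.toReal_mono
    (ENNReal.mul_ne_top (ENNReal.mul_ne_top ENNReal.ofReal_ne_top hVt) (hfin J2)) hvol
  simp only [ENNReal.toReal_mul] at hr
  rw [ENNReal.toReal_ofReal hε.le, ENNReal.toReal_ofReal (by positivity)] at hr
  set a1 := (volume (f ⁻¹' J1 ∩ K)).toReal
  set a2 := (volume (f ⁻¹' J2 ∩ K)).toReal with ha2
  set a3 := (volume (f ⁻¹' J3 ∩ K)).toReal
  have ha2n : 0 ≤ a2 := ENNReal.toReal_nonneg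
  simp only [← hVdef] at hr hsup
  generalize ∫ x in K, |f x - m| = I at hsup
  calc ε * (V⁻¹ * a1) * (V⁻¹ * a3) = V⁻¹ * V⁻¹ * (ε * a1 * a3) := by ring
    _ ≤ V⁻¹ * V⁻¹ * (C2 * |f x0 - m| * V * a2) := by gcongr
    _ = V⁻¹ * V⁻¹ * (C2 * a2 * (|f x0 - m| * V)) := by ring
    _ ≤ V⁻¹ * V⁻¹ * (C2 * a2 * (C1 * I)) := by gcongr
    _ = _ := by ring
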